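/- Let N ≥ 2 be an integer, let f_1, …, f_N, g, h, E be real numbers with f_N ≠ 0 and 2E − g·f_N² ≠ 0, and let ψ ∈ ℂ^N satisfy, for every n ∈ {1,…,N}: E·ψ_n = (1/2) Σ_{m=1}^{N} f_n·( g + i·h·sign(n − m) )·f_m·ψ_m. Then, setting g′ = g + (g² + h²)·f_N² / (2E − g·f_N²), the truncated vector (ψ_1, …, ψ_{N−1}) satisfies, for every n ∈ {1,…,N−1}: E·ψ_n = (1/2) Σ_{m=1}^{N−1} f_n·( g′ + i·h·sign(n − m) )·f_m·ψ_m. -/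

import Mathlib

open Complex Finset

/-- One-step renormalization group transformation of the inverse Berry–Keating model:
eliminating the highest component `ψ_N` reproduces the same Hamiltonian on `N-1` sites
with `g` renormalized to `g' = g + (g² + h²) f_N² / (2E − g f_N²)`. -/
theorem inverse_model_RG_step
    (N : ℕ) (hN : 2 ≤ N) (f : ℕ → ℝ) (g h E : ℝ)
    (hfN : f N ≠ 0) (hden : 2 * E - g * (f N) ^ 2 ≠ 0)
    (ψ : ℕ → ℂ)
    (heq : ∀ n ∈ Finset.Icc 1 N,
      (E : ℂ) * ψ n = (1 / 2 : ℂ) * ∑ m ∈ Finset.Icc 1 N,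
        (f n : ℂ) * ((g : ℂ) + Complex.I * (h : ℂ) * (Real.sign ((n : ℝ) - (m : ℝ)) : ℂ)) *
          (f m : ℂ) * ψ m) :
    ∀ n ∈ Finset.Icc 1 (N - 1),
      (E : ℂ) * ψ n = (1 / 2 : ℂ) * ∑ m ∈ Finset.Icc 1 (N - 1),
        (f n : ℂ) *
          (((g + (g ^ 2 + h ^ 2) * (f N) ^ 2 / (2 * E - g * (f N) ^ 2) : ℝ) : ℂ) +
            Complex.I * (h : ℂ) * (Real.sign ((n : ℝ) - (m : ℝ)) : ℂ)) *
          (f m : ℂ) * ψ m := by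
  obtain ⟨k, rfl⟩ : ∃ k, N = k + 1 := ⟨N - 1, by omega⟩
  intro n hn
  simp only [Nat.add_sub_cancel] at hn ⊢
  obtain ⟨hn1, hnk⟩ := Finset.mem_Icc.mp hn
  have hD : (2 * E - g * (f (k + 1)) ^ 2 : ℂ) ≠ 0 := by exact_mod_cast hden
  set S : ℂ := ∑ m ∈ Finset.Icc 1 k, (f m : ℂ) * ψ m with hS
  -- the equation for the highest component determines it in terms of `S`
  have htop : (2 * E - g * (f (k + 1)) ^ 2 : ℂ) * ψ (k + 1) =
      f (k + 1) * (g + Complex.I * h) * S := by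
    have h1 := heq (k + 1) (by simp)
    rw [Finset.sum_Icc_succ_top (by omega)] at h1
    have h2 : ∑ m ∈ Finset.Icc 1 k, (f (k + 1) : ℂ) * ((g : ℂ) + Complex.I * (h : ℂ) *
        (Real.sign (((k + 1 : ℕ) : ℝ) - (m : ℝ)) : ℂ)) * (f m : ℂ) * ψ m =
        f (k + 1) * (g + Complex.I * h) * S := by
      rw [hS, Finset.mul_sum]
      refine Finset.sum_congr rfl fun m hm => ?_
      have hlt : (m : ℝ) < ((k + 1 : ℕ) : ℝ) := by
        exact_mod_cast Nat.lt_succ_of_le (Finset.mem_Icc.mp hm).2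
      rw [Real.sign_of_pos (sub_pos.mpr hlt)]
      push_cast
      ring
    rw [h2, sub_self, Real.sign_zero, Complex.ofReal_zero] at h1
    linear_combination 2 * h1
  have hlow := heq n (Finset.mem_Icc.mpr ⟨hn1, by omega⟩)
  rw [Finset.sum_Icc_succ_top (by omega)] at hlow
  have hlt : (n : ℝ) < ((k + 1 : ℕ) : ℝ) := by exact_mod_cast Nat.lt_succ_of_le hnk
  rw [Real.sign_of_neg (sub_neg.mpr hlt)] at hlow
  have hψ : ψ (k + 1) =
      f (k + 1) * (g + Complex.I * h) * S / (2 * E - g * (f (k + 1)) ^ 2 : ℂ) := by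
    rw [eq_div_iff hD, mul_comm, htop]
  rw [hlow]
  congr 1
  have hshift : ∀ c : ℂ, ∑ m ∈ Finset.Icc 1 k, (f n : ℂ) * (((g : ℂ) + c) +
        Complex.I * (h : ℂ) * (Real.sign ((n : ℝ) - (m : ℝ)) : ℂ)) * (f m : ℂ) * ψ m =
      ∑ m ∈ Finset.Icc 1 k, (f n : ℂ) * ((g : ℂ) +
        Complex.I * (h : ℂ) * (Real.sign ((n : ℝ) - (m : ℝ)) : ℂ)) * (f m : ℂ) * ψ m +
      f n * c * S := by
    intro c
    rw [hS, Finset.mul_sum, ← Finset.sum_add_distrib]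
    exact Finset.sum_congr rfl fun m _ => by ring
  rw [Complex.ofReal_add, hshift, hψ]
  congr 1
  push_cast
  field_simp
  linear_combination (-(f n : ℂ) * f (k + 1) ^ 2 * S * h ^ 2) * Complex.I_sq
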